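/- Let x, y : ℝ → S³ ⊂ ℝ⁴ be C¹ curves with x(s) ≠ y(t) for all s, t, and let σ(s,t) = P(x̄(s), ȳ(t)) / (1 − x(s)·y(t)) ∈ ℝ¹⁰. Then both partial derivatives of σ are null vectors of the pseudo-Riemannian structure: Q(∂σ/∂s, ∂σ/∂s) = 0 and Q(∂σ/∂t, ∂σ/∂t) = 0 for all (s,t). -/

import Mathlib

open Matrix

/-- Index set for the 10 Plücker coordinates: pairs `0 ≤ i < j ≤ 4`. -/
abbrev PIdx : Type := {p : Fin 5 × Fin 5 // p.1 < p.2}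

/-- The Plücker vector of a pair of vectors in ℝ⁵. -/
noncomputable def Pl (u v : Fin 5 → ℝ) : PIdx → ℝ :=
  fun I => u I.1.1 * v I.1.2 - u I.1.2 * v I.1.1

/-- The indefinite inner product of signature (4,6) on `Λ²ℝ⁵₁ ≅ ℝ¹⁰`:
`ε_{0j} = +1` and `ε_{ij} = −1` for `1 ≤ i < j`. -/
noncomputable def Q (z w : PIdx → ℝ) : ℝ :=
  ∑ I : PIdx, (if I.1.1 = 0 then (1:ℝ) else -1) * z I * w I

/-- The lightlike lift `x̄ = (1, x) ∈ ℝ⁵` of a point of `S³ ⊂ ℝ⁴`. -/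
noncomputable def lift (x : Fin 4 → ℝ) : Fin 5 → ℝ := Fin.cons 1 x

/-- The Lorentzian inner product on `ℝ⁵`, of signature `(4,1)`. -/
def lorentz (u v : Fin 5 → ℝ) : ℝ := ∑ i, (if i = 0 then (-1 : ℝ) else 1) * u i * v i

theorem lorentz_lift (x y : Fin 4 → ℝ) : lorentz (lift x) (lift y) = x ⬝ᵥ y - 1 := by
  simp [lorentz, lift, Fin.sum_univ_succ, dotProduct]
  ring

theorem Q_Pl_self (u v : Fin 5 → ℝ) :
    Q (Pl u v) (Pl u v) = lorentz u v ^ 2 - lorentz u u * lorentz v v := by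
  have h : Q (Pl u v) (Pl u v) = ∑ p : Fin 5 × Fin 5, if p.1 < p.2 then
      (if p.1 = 0 then (1 : ℝ) else -1) * (u p.1 * v p.2 - u p.2 * v p.1) *
        (u p.1 * v p.2 - u p.2 * v p.1) else 0 := by
    rw [← Finset.sum_filter]
    exact Eq.symm (Finset.sum_subtype _ (by simp) _)
  rw [h, Fintype.sum_prod_type]
  simp [Fin.sum_univ_five, lorentz]
  ring

theorem Pl_swap (u v : Fin 5 → ℝ) : Pl v u = -Pl u v := by
  ext I
  simp only [Pl, Pi.neg_apply]
  ring

theorem Pl_smul_left (r : ℝ) (u v : Fin 5 → ℝ) : Pl (r • u) v = r • Pl u v := by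
  ext I
  simp only [Pl, Pi.smul_apply, smul_eq_mul]
  ring

theorem Q_neg_neg (z w : PIdx → ℝ) : Q (-z) (-w) = Q z w := by
  simp [Q]

theorem hasDerivAt_Pl_left {c : ℝ → Fin 5 → ℝ} {c' : Fin 5 → ℝ} {s : ℝ}
    (hc : HasDerivAt c c' s) (v : Fin 5 → ℝ) :
    HasDerivAt (fun a => Pl (c a) v) (Pl c' v) s := by
  rw [hasDerivAt_pi] at hc ⊢
  exact fun I => ((hc I.1.1).mul_const _).sub ((hc I.1.2).mul_const _)

theorem hasDerivAt_lorentz_left {c : ℝ → Fin 5 → ℝ} {c' : Fin 5 → ℝ} {s : ℝ}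
    (hc : HasDerivAt c c' s) (v : Fin 5 → ℝ) :
    HasDerivAt (fun a => lorentz (c a) v) (lorentz c' v) s := by
  rw [hasDerivAt_pi] at hc
  exact HasDerivAt.fun_sum fun i _ => ((hc i).const_mul _).mul_const _

/-- Moving one factor of a Plücker vector along a curve in an affine hyperplane
`lorentz · v = k`, with the other factor a fixed lightlike `v`, gives a null velocity. -/
theorem Q_deriv_Pl_eq_zero {c : ℝ → Fin 5 → ℝ} {s k : ℝ} {v : Fin 5 → ℝ}
    (hc : DifferentiableAt ℝ c s) (hv : lorentz v v = 0) (hk : ∀ a, lorentz (c a) v = k) :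
    Q (deriv (fun a => Pl (c a) v) s) (deriv (fun a => Pl (c a) v) s) = 0 := by
  have h : lorentz (deriv c s) v = 0 := by
    have h1 := hasDerivAt_lorentz_left hc.hasDerivAt v
    simp only [hk] at h1
    exact h1.unique (hasDerivAt_const s k)
  rw [(hasDerivAt_Pl_left hc.hasDerivAt v).deriv, Q_Pl_self, h, hv]
  ring

theorem dotProduct_ne_one_of_ne {x y : Fin 4 → ℝ} (hx : x ⬝ᵥ x = 1) (hy : y ⬝ᵥ y = 1)
    (h : x ≠ y) : x ⬝ᵥ y ≠ 1 := by
  intro hxy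
  refine h (sub_eq_zero.mp (dotProduct_self_eq_zero.mp ?_))
  rw [sub_dotProduct, dotProduct_sub, dotProduct_sub, dotProduct_comm y x, hx, hy, hxy]
  ring

theorem differentiableAt_lift {x : ℝ → Fin 4 → ℝ} {s : ℝ} (hx : DifferentiableAt ℝ x s) :
    DifferentiableAt ℝ (fun a => lift (x a)) s := by
  rw [differentiableAt_pi] at hx ⊢
  intro i
  refine Fin.cases ?_ (fun j => ?_) i
  · simp [lift]
  · simpa [lift] using hx j

theorem Q_deriv_normalized_Pl_eq_zero {x : ℝ → Fin 4 → ℝ} {s : ℝ} {p : Fin 4 → ℝ}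
    (hx : DifferentiableAt ℝ x s) (hp : p ⬝ᵥ p = 1) (hxp : ∀ a, x a ⬝ᵥ p ≠ 1) :
    Q (deriv (fun a => (1 - x a ⬝ᵥ p)⁻¹ • Pl (lift (x a)) (lift p)) s)
      (deriv (fun a => (1 - x a ⬝ᵥ p)⁻¹ • Pl (lift (x a)) (lift p)) s) = 0 := by
  have hne : ∀ a, 1 - x a ⬝ᵥ p ≠ 0 := fun a => sub_ne_zero.mpr (hxp a).symm
  have hdot : DifferentiableAt ℝ (fun a => x a ⬝ᵥ p) s := by
    rw [differentiableAt_pi] at hx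
    exact DifferentiableAt.fun_sum fun i _ => (hx i).mul_const _
  simp only [← Pl_smul_left]
  refine Q_deriv_Pl_eq_zero (k := -1)
    (((hdot.const_sub 1).inv (hne s)).smul (differentiableAt_lift hx))
    (by rw [lorentz_lift, hp, sub_self]) fun a => ?_
  have hsmul : ∀ (r : ℝ) (u v : Fin 5 → ℝ), lorentz (r • u) v = r * lorentz u v := by
    intro r u v
    simp only [lorentz, Finset.mul_sum, Pi.smul_apply, smul_eq_mul]
    exact Finset.sum_congr rfl fun i _ => by ring
  rw [hsmul, lorentz_lift]
  have := hne a
  field_simp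
  ring

/-- both partial derivatives of the torus parametrization
`σ(s,t) = P(x̄(s), ȳ(t))/(1 − x(s)·y(t))` are null vectors for `Q`. -/
theorem partials_of_sigma_are_null
    (x y : ℝ → (Fin 4 → ℝ))
    (hx : ContDiff ℝ 1 x) (hy : ContDiff ℝ 1 y)
    (hxS : ∀ s, x s ⬝ᵥ x s = 1) (hyS : ∀ t, y t ⬝ᵥ y t = 1)
    (hdisj : ∀ s t, x s ≠ y t)
    (σ : ℝ → ℝ → (PIdx → ℝ))
    (hσ : ∀ s t, σ s t = (1 - x s ⬝ᵥ y t)⁻¹ • Pl (lift (x s)) (lift (y t))) :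
    ∀ s t : ℝ,
      Q (deriv (fun a => σ a t) s) (deriv (fun a => σ a t) s) = 0 ∧
      Q (deriv (fun b => σ s b) t) (deriv (fun b => σ s b) t) = 0 := by
  intro s t
  have hne : ∀ s t, x s ⬝ᵥ y t ≠ 1 := fun s t =>
    dotProduct_ne_one_of_ne (hxS s) (hyS t) (hdisj s t)
  constructor
  · simp only [hσ]
    exact Q_deriv_normalized_Pl_eq_zero (hx.differentiable one_ne_zero s) (hyS t) (hne · t)
  · simp only [hσ, Pl_swap (lift (y _)) (lift (x s)), smul_neg, deriv.fun_neg, Q_neg_neg,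
      dotProduct_comm (x s)]
    exact Q_deriv_normalized_Pl_eq_zero (hy.differentiable one_ne_zero t) (hxS s)
      fun b => dotProduct_comm (x s) (y b) ▸ hne s b
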